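/- Every nontrivial real Lie superalgebra L of dimension 4 has trivial Bogomolov multiplier B̃₀(L) = 0. In particular B̃₀ vanishes for all Backhouse classes of types (3,1), (2,2) and (1,3); for example for L³(3,1) = ⟨a,b,c | α : [a,b]=b, [a,c]=b+c, [a,α]=½α, [α,α]=b⟩, for L¹(2,2) = ⟨a,b | α,β : [a,b]=b, [a,α]=½α, [a,β]=½β, [α,α]=b, [β,β]=b⟩, for L¹¹(2,2) = ⟨a,b | α,β : [α,α]=a, [β,β]=b, [α,β]=p(a+b), p > 0⟩, and for L¹(1,3) = ⟨a | α,β,γ : [α,α]=a, [β,β]=a, [γ,γ]=a⟩. -/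

import Mathlib

/-!
Basic definitions for Lie superalgebras over a commutative ring `K`,
graded ideals, the nonabelian (CP) exterior products and the Bogomolov multiplier.
-/

universe u v

namespace BogomolovSuper

/-- The sign `(-1)^{|i||j|}` attached to a pair of `ℤ₂`-degrees. -/
def sgn (i j : ZMod 2) : ℤ := (-1) ^ (i.val * j.val)

/-- A Lie superalgebra structure on a `K`-module `L`: a `ℤ₂`-grading
`gr` with `L = gr 0 ⊕ gr 1` together with a super bracket satisfying
super skew-symmetry, the super Jacobi identity and `[x,x] = 0` for even `x`. -/
structure SuperAlg (K : Type u) [CommRing K] (L : Type v)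
    [AddCommGroup L] [Module K L] where
  bk : L →ₗ[K] L →ₗ[K] L
  gr : ZMod 2 → Submodule K L
  gr_inf : gr 0 ⊓ gr 1 = ⊥
  gr_sup : gr 0 ⊔ gr 1 = ⊤
  bk_gr : ∀ i j : ZMod 2, ∀ x ∈ gr i, ∀ y ∈ gr j, bk x y ∈ gr (i + j)
  skew : ∀ i j : ZMod 2, ∀ x ∈ gr i, ∀ y ∈ gr j, bk x y = -(sgn i j • bk y x)
  jacobi : ∀ i j : ZMod 2, ∀ x ∈ gr i, ∀ y ∈ gr j, ∀ z : L,
    bk x (bk y z) = bk (bk x y) z + sgn i j • bk y (bk x z)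
  even_sq : ∀ x ∈ gr 0, bk x x = 0

variable {K : Type u} [CommRing K]

section Defs

variable {L L' E : Type v} [AddCommGroup L] [Module K L]
  [AddCommGroup L'] [Module K L'] [AddCommGroup E] [Module K E]

/-- A homomorphism of Lie superalgebras of even degree (degree zero). -/
def IsSuperHom (s : SuperAlg K L) (s' : SuperAlg K L') (f : L →ₗ[K] L') : Prop :=
  (∀ x y : L, f (s.bk x y) = s'.bk (f x) (f y)) ∧
  (∀ i : ZMod 2, ∀ x ∈ s.gr i, f x ∈ s'.gr i)

/-- A graded (homogeneous) ideal of a Lie superalgebra. -/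
def IsGradedIdeal (s : SuperAlg K L) (M : Submodule K L) : Prop :=
  (∀ x : L, ∀ m ∈ M, s.bk x m ∈ M ∧ s.bk m x ∈ M) ∧
  (∀ m ∈ M, ∃ m₀ ∈ M ⊓ s.gr 0, ∃ m₁ ∈ M ⊓ s.gr 1, m = m₀ + m₁)

/-- The sub-Lie-superalgebra generated by a set: the smallest submodule
containing the set and closed under the bracket. -/
def lieSpan (s : SuperAlg K E) (S : Set E) : Submodule K E :=
  sInf {p : Submodule K E | S ⊆ p ∧ ∀ x ∈ p, ∀ y ∈ p, s.bk x y ∈ p}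

/-- `K(L)`: the set of all brackets `[a,b]`. -/
def bkSet (s : SuperAlg K L) : Set L := {x : L | ∃ a b : L, x = s.bk a b}

/-- The derived subalgebra `L² = [L,L]` (as a submodule; it is a graded ideal). -/
def derived (s : SuperAlg K L) : Submodule K L := Submodule.span K (bkSet s)

/-- The descending central series of a Lie superalgebra. -/
def lcs (s : SuperAlg K L) : ℕ → Submodule K L
  | 0 => ⊤
  | n + 1 => Submodule.span K {x : L | ∃ a ∈ lcs s n, ∃ b : L, x = s.bk a b}

/-- Nilpotency of a Lie superalgebra. -/
def IsNilpotentSuper (s : SuperAlg K L) : Prop := ∃ c : ℕ, lcs s c = ⊥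

/-- A Lie super exterior pairing on a pair of graded ideals `M`, `N` of `(L, s)`,
with values in a Lie superalgebra `(E, t)`. -/
structure IsExtPairing (s : SuperAlg K L) (M N : Submodule K L)
    (t : SuperAlg K E) (ρ : L → L → E) : Prop where
  grade : ∀ i j : ZMod 2, ∀ m ∈ M ⊓ s.gr i, ∀ n ∈ N ⊓ s.gr j, ρ m n ∈ t.gr (i + j)
  smul_left : ∀ (c : K) (i j : ZMod 2), ∀ m ∈ M ⊓ s.gr i, ∀ n ∈ N ⊓ s.gr j,
    ρ (c • m) n = c • ρ m n
  smul_right : ∀ (c : K) (i j : ZMod 2), ∀ m ∈ M ⊓ s.gr i, ∀ n ∈ N ⊓ s.gr j,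
    ρ m (c • n) = c • ρ m n
  add_left : ∀ (i j : ZMod 2), ∀ m ∈ M ⊓ s.gr i, ∀ m' ∈ M ⊓ s.gr i, ∀ n ∈ N ⊓ s.gr j,
    ρ (m + m') n = ρ m n + ρ m' n
  add_right : ∀ (i j : ZMod 2), ∀ m ∈ M ⊓ s.gr i, ∀ n ∈ N ⊓ s.gr j, ∀ n' ∈ N ⊓ s.gr j,
    ρ m (n + n') = ρ m n + ρ m n'
  bk_left : ∀ (i i' j : ZMod 2), ∀ m ∈ M ⊓ s.gr i, ∀ m' ∈ M ⊓ s.gr i', ∀ n ∈ N ⊓ s.gr j,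
    ρ (s.bk m m') n = ρ m (s.bk m' n) - sgn i i' • ρ m' (s.bk m n)
  bk_right : ∀ (i j j' : ZMod 2), ∀ m ∈ M ⊓ s.gr i, ∀ n ∈ N ⊓ s.gr j, ∀ n' ∈ N ⊓ s.gr j',
    ρ m (s.bk n n') = sgn j' (i + j) • ρ (s.bk n' m) n - sgn i j • ρ (s.bk n m) n'
  bk_pair : ∀ (i j i' j' : ZMod 2), ∀ m ∈ M ⊓ s.gr i, ∀ n ∈ N ⊓ s.gr j,
    ∀ m' ∈ M ⊓ s.gr i', ∀ n' ∈ N ⊓ s.gr j',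
    t.bk (ρ m n) (ρ m' n') = -(sgn i j • ρ (s.bk n m) (s.bk m' n'))

/-- A Lie super `B̃₀`-pairing: an exterior pairing that moreover kills the
commutativity-preserving relations. -/
structure IsB0Pairing (s : SuperAlg K L) (M N : Submodule K L)
    (t : SuperAlg K E) (ρ : L → L → E)
    extends IsExtPairing s M N t ρ : Prop where
  rel_pair : ∀ (i j i' j' : ZMod 2), ∀ m ∈ M ⊓ s.gr i, ∀ n ∈ N ⊓ s.gr j,
    ∀ m' ∈ M ⊓ s.gr i', ∀ n' ∈ N ⊓ s.gr j',
    s.bk m n + sgn i' j' • s.bk m' n' = 0 → ρ m n + sgn i' j' • ρ m' n' = 0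
  rel_even : ∀ m ∈ M ⊓ s.gr 0, ∀ n ∈ N ⊓ s.gr 0, s.bk m n = 0 → ρ m n = 0

/-- The set of wedge generators `m ∧ n` (`m`, `n` homogeneous). -/
def wedgeSet (s : SuperAlg K L) (M N : Submodule K L) (ρ : L → L → E) : Set E :=
  {e : E | ∃ i j : ZMod 2, ∃ m ∈ M ⊓ s.gr i, ∃ n ∈ N ⊓ s.gr j, e = ρ m n}

/-- `(E, t, ρ)` is the nonabelian exterior product `M ∧ N`: `ρ` is a universal
exterior pairing whose image generates `E`. -/
structure IsExtProduct (s : SuperAlg K L) (M N : Submodule K L)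
    (t : SuperAlg K E) (ρ : L → L → E) : Prop where
  pairing : IsExtPairing s M N t ρ
  gen : Submodule.span K (wedgeSet s M N ρ) = ⊤
  lift : ∀ {E' : Type v} [AddCommGroup E'] [Module K E'],
    ∀ (t' : SuperAlg K E') (ρ' : L → L → E'), IsExtPairing s M N t' ρ' →
    ∃ f : E →ₗ[K] E', IsSuperHom t t' f ∧
      ∀ (i j : ZMod 2), ∀ m ∈ M ⊓ s.gr i, ∀ n ∈ N ⊓ s.gr j, f (ρ m n) = ρ' m n

/-- `(E, t, ρ)` is the commutativity preserving (CP) exterior product `M ⋏ N`: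
`ρ` is a universal `B̃₀`-pairing whose image generates `E`. -/
structure IsCPProduct (s : SuperAlg K L) (M N : Submodule K L)
    (t : SuperAlg K E) (ρ : L → L → E) : Prop where
  pairing : IsB0Pairing s M N t ρ
  gen : Submodule.span K (wedgeSet s M N ρ) = ⊤
  lift : ∀ {E' : Type v} [AddCommGroup E'] [Module K E'],
    ∀ (t' : SuperAlg K E') (ρ' : L → L → E'), IsB0Pairing s M N t' ρ' →
    ∃ f : E →ₗ[K] E', IsSuperHom t t' f ∧
      ∀ (i j : ZMod 2), ∀ m ∈ M ⊓ s.gr i, ∀ n ∈ N ⊓ s.gr j, f (ρ m n) = ρ' m n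

/-- Generators of `M₀(M,N)` inside the exterior product. -/
def M0Set (s : SuperAlg K L) (M N : Submodule K L) (ρ : L → L → E) : Set E :=
  {e : E | ∃ i j i' j' : ZMod 2, ∃ m ∈ M ⊓ s.gr i, ∃ n ∈ N ⊓ s.gr j,
      ∃ m' ∈ M ⊓ s.gr i', ∃ n' ∈ N ⊓ s.gr j',
      s.bk m n + sgn i' j' • s.bk m' n' = 0 ∧ e = ρ m n + sgn i' j' • ρ m' n'} ∪
  {e : E | ∃ m ∈ M ⊓ s.gr 0, ∃ n ∈ N ⊓ s.gr 0, s.bk m n = 0 ∧ e = ρ m n}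

/-- `M₀(M,N)`, the graded submodule of the exterior product generated
by the commutativity-preserving relations. -/
def M0 (s : SuperAlg K L) (M N : Submodule K L) (ρ : L → L → E) : Submodule K E :=
  Submodule.span K (M0Set s M N ρ)

/-- `κ` is the commutator map `κ̃ : m ∧ n ↦ [m,n]`. -/
def IsCommMap (s : SuperAlg K L) (M N : Submodule K L) (ρ : L → L → E)
    (κ : E →ₗ[K] L) : Prop :=
  ∀ (i j : ZMod 2), ∀ m ∈ M ⊓ s.gr i, ∀ n ∈ N ⊓ s.gr j, κ (ρ m n) = s.bk m n

/-- The Bogomolov multiplier `B̃₀(L) = M(L)/M₀(L)` of `(L,s)` is trivial: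
for any realization of the exterior product `L ∧ L` and of the commutator
map `κ̃`, the kernel `M(L)` of `κ̃` is contained in `M₀(L)`. -/
def HasTrivialBog (s : SuperAlg K L) : Prop :=
  ∀ {E' : Type v} [AddCommGroup E'] [Module K E'],
    ∀ (t : SuperAlg K E') (w : L → L → E'), IsExtProduct s ⊤ ⊤ t w →
    ∀ κ : E' →ₗ[K] L, IsCommMap s ⊤ ⊤ w κ → LinearMap.ker κ ≤ M0 s ⊤ ⊤ w

end Defs

section Free

variable {F : Type v} [AddCommGroup F] [Module K F]

/-- `(F, sF)` is the free Lie superalgebra on the `ℤ₂`-graded set `X`. -/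
structure IsFreeSuper (sF : SuperAlg K F) (X : ZMod 2 → Set F) : Prop where
  subset : ∀ i : ZMod 2, X i ⊆ sF.gr i
  gen : lieSpan sF (X 0 ∪ X 1) = ⊤
  lift : ∀ {M : Type v} [AddCommGroup M] [Module K M],
    ∀ (sM : SuperAlg K M) (f : F → M), (∀ i : ZMod 2, ∀ x ∈ X i, f x ∈ sM.gr i) →
    ∃ g : F →ₗ[K] M, IsSuperHom sF sM g ∧ ∀ x ∈ X 0 ∪ X 1, g x = f x

end Free

end BogomolovSuper

namespace BogomolovSuper

section Coordinates

variable {L : Type v} [AddCommGroup L] [Module ℝ L]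

lemma exists_span_pair {p : Submodule ℝ L} (h : Module.finrank ℝ p = 2) :
    ∃ a ∈ p, ∃ b ∈ p, ∀ x ∈ p, ∃ c d : ℝ, x = c • a + d • b := by
  have : FiniteDimensional ℝ p := Module.finite_of_finrank_pos (by omega)
  let e := Module.finBasisOfFinrankEq ℝ p h
  refine ⟨e 0, (e 0).2, e 1, (e 1).2, fun x hx => ⟨e.repr ⟨x, hx⟩ 0, e.repr ⟨x, hx⟩ 1, ?_⟩⟩
  have hsum := e.sum_repr ⟨x, hx⟩
  rw [Fin.sum_univ_two] at hsum
  exact (congrArg Subtype.val hsum).symm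

lemma exists_span_triple {p : Submodule ℝ L} (h : Module.finrank ℝ p = 3) :
    ∃ a ∈ p, ∃ b ∈ p, ∃ c ∈ p, ∀ x ∈ p, ∃ r t q : ℝ, x = r • a + t • b + q • c := by
  have : FiniteDimensional ℝ p := Module.finite_of_finrank_pos (by omega)
  let e := Module.finBasisOfFinrankEq ℝ p h
  refine ⟨e 0, (e 0).2, e 1, (e 1).2, e 2, (e 2).2, fun x hx =>
    ⟨e.repr ⟨x, hx⟩ 0, e.repr ⟨x, hx⟩ 1, e.repr ⟨x, hx⟩ 2, ?_⟩⟩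
  have hsum := e.sum_repr ⟨x, hx⟩
  rw [Fin.sum_univ_three] at hsum
  exact (congrArg Subtype.val hsum).symm

lemma exists_smul_eq {p : Submodule ℝ L} (h : Module.finrank ℝ p = 1) {a : L}
    (ha : a ∈ p) (ha0 : a ≠ 0) {x : L} (hx : x ∈ p) : ∃ c : ℝ, c • a = x := by
  have ha' : (⟨a, ha⟩ : p) ≠ 0 := fun h0 => ha0 (congrArg Subtype.val h0)
  obtain ⟨c, hc⟩ := (finrank_eq_one_iff_of_nonzero' _ ha').1 h ⟨x, hx⟩
  exact ⟨c, congrArg Subtype.val hc⟩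

end Coordinates

section Degrees

lemma sgn_mul_self (i j : ZMod 2) : sgn i j * sgn i j = 1 := by
  simp [sgn, ← mul_pow]

lemma sgn_zero_left (j : ZMod 2) : sgn 0 j = 1 := by simp [sgn]

lemma sgn_one_one : sgn 1 1 = -1 := by simp [sgn, ZMod.val_one]

lemma zmod_two_eq (i : ZMod 2) : i = 0 ∨ i = 1 := by
  revert i; decide

lemma zmod_two_add_eq_zero {i j : ZMod 2} (h : i + j = 0) :
    (i = 0 ∧ j = 0) ∨ (i = 1 ∧ j = 1) := by
  revert i j; decide

lemma zmod_two_add_eq_one {i j : ZMod 2} (h : i + j = 1) :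
    (i = 0 ∧ j = 1) ∨ (i = 1 ∧ j = 0) := by
  revert i j; decide

end Degrees

section Bracket

variable {L : Type v} [AddCommGroup L] [Module ℝ L] (s : SuperAlg ℝ L)

lemma bk_swap_of_even_odd {x y : L} (hx : x ∈ s.gr 0) (hy : y ∈ s.gr 1) :
    s.bk x y = -s.bk y x := by
  simpa [sgn_zero_left] using s.skew 0 1 x hx y hy

lemma bk_swap_of_even {x y : L} (hx : x ∈ s.gr 0) (hy : y ∈ s.gr 0) :
    s.bk x y = -s.bk y x := by
  simpa [sgn_zero_left] using s.skew 0 0 x hx y hy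

lemma bk_comm_of_odd {x y : L} (hx : x ∈ s.gr 1) (hy : y ∈ s.gr 1) :
    s.bk x y = s.bk y x := by
  simpa [sgn_one_one] using s.skew 1 1 x hx y hy

lemma bk_bk_self_of_odd {h z : L} (hh : h ∈ s.gr 0) (hz : z ∈ s.gr 1) :
    s.bk h (s.bk z z) = (2 : ℝ) • s.bk (s.bk h z) z := by
  have hhz : s.bk h z ∈ s.gr 1 := by simpa using s.bk_gr 0 1 h hh z hz
  rw [s.jacobi 0 1 h hh z hz z, sgn_zero_left, one_smul, bk_comm_of_odd s hz hhz, two_smul]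

lemma isCompl_gr : IsCompl (s.gr 0) (s.gr 1) :=
  ⟨disjoint_iff.2 s.gr_inf, codisjoint_iff.2 s.gr_sup⟩

end Bracket

/-- A bilinear map `W` on a Lie superalgebra which lifts the bracket along `κ`, takes the same
value on pairs of homogeneous elements with equal brackets, and whose values on such pairs span. -/
structure IsBracketCover {L Q : Type v} [AddCommGroup L] [Module ℝ L] [AddCommGroup Q] [Module ℝ Q]
    (s : SuperAlg ℝ L) (W : L →ₗ[ℝ] L →ₗ[ℝ] Q) (κ : Q →ₗ[ℝ] L) : Prop where
  map_eq_bk : ∀ (i j : ZMod 2), ∀ m ∈ s.gr i, ∀ n ∈ s.gr j, κ (W m n) = s.bk m n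
  eq_of_bk_eq : ∀ {i j i' j' : ZMod 2} {m n m' n' : L}, m ∈ s.gr i → n ∈ s.gr j →
    m' ∈ s.gr i' → n' ∈ s.gr j' → s.bk m n = s.bk m' n' → W m n = W m' n'
  span_eq_top : Submodule.span ℝ
    {q : Q | ∃ i j : ZMod 2, ∃ m ∈ s.gr i, ∃ n ∈ s.gr j, q = W m n} = ⊤

section Cover

variable {L Q : Type v} [AddCommGroup L] [Module ℝ L] [AddCommGroup Q] [Module ℝ Q]

/-- The span of the values of `W` on homogeneous pairs of total degree `k`. -/
def coverPart (s : SuperAlg ℝ L) (W : L →ₗ[ℝ] L →ₗ[ℝ] Q) (k : ZMod 2) : Submodule ℝ Q :=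
  Submodule.span ℝ {q : Q | ∃ i j : ZMod 2, i + j = k ∧ ∃ m ∈ s.gr i, ∃ n ∈ s.gr j, q = W m n}

namespace IsBracketCover

variable {s : SuperAlg ℝ L} {W : L →ₗ[ℝ] L →ₗ[ℝ] Q} {κ : Q →ₗ[ℝ] L}

lemma eq_zero_of_bk_eq_zero (h : IsBracketCover s W κ) {i j : ZMod 2} {m n : L}
    (hm : m ∈ s.gr i) (hn : n ∈ s.gr j) (hmn : s.bk m n = 0) : W m n = 0 := by
  simpa using h.eq_of_bk_eq hm hn (zero_mem (s.gr i)) hn (by simpa using hmn)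

lemma add_eq_zero_of_map_eq_zero (h : IsBracketCover s W κ) {i j i' j' : ZMod 2}
    {m n m' n' : L} (hm : m ∈ s.gr i) (hn : n ∈ s.gr j) (hm' : m' ∈ s.gr i')
    (hn' : n' ∈ s.gr j') (h0 : κ (W m n + W m' n') = 0) : W m n + W m' n' = 0 := by
  rw [map_add, h.map_eq_bk i j m hm n hn, h.map_eq_bk i' j' m' hm' n' hn'] at h0
  have := h.eq_of_bk_eq hm hn (neg_mem hm') hn' (by simpa using eq_neg_of_add_eq_zero_left h0)
  simp [this]

lemma swap_of_even_odd (h : IsBracketCover s W κ) {x y : L} (hx : x ∈ s.gr 0)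
    (hy : y ∈ s.gr 1) : W y x = -W x y := by
  have := h.eq_of_bk_eq hy hx (neg_mem hx) hy (by simp [bk_swap_of_even_odd s hx hy])
  simpa using this

lemma swap_of_even (h : IsBracketCover s W κ) {x y : L} (hx : x ∈ s.gr 0)
    (hy : y ∈ s.gr 0) : W y x = -W x y := by
  have := h.eq_of_bk_eq hy hx (neg_mem hx) hy (by simp [bk_swap_of_even s hx hy])
  simpa using this

lemma self_of_even (h : IsBracketCover s W κ) {x : L} (hx : x ∈ s.gr 0) : W x x = 0 :=
  h.eq_zero_of_bk_eq_zero hx hx (s.even_sq x hx)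

lemma map_coverPart_le (h : IsBracketCover s W κ) (k : ZMod 2) {q : Q}
    (hq : q ∈ coverPart s W k) : κ q ∈ s.gr k := by
  suffices coverPart s W k ≤ (s.gr k).comap κ from this hq
  refine Submodule.span_le.2 ?_
  rintro _ ⟨i, j, rfl, m, hm, n, hn, rfl⟩
  simpa [h.map_eq_bk i j m hm n hn] using s.bk_gr i j m hm n hn

lemma coverPart_sup (h : IsBracketCover s W κ) :
    coverPart s W 0 ⊔ coverPart s W 1 = ⊤ := by
  rw [eq_top_iff, ← h.span_eq_top]
  refine Submodule.span_le.2 ?_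
  rintro _ ⟨i, j, m, hm, n, hn, rfl⟩
  rcases zmod_two_eq (i + j) with hij | hij
  · exact Submodule.mem_sup_left (Submodule.subset_span ⟨i, j, hij, m, hm, n, hn, rfl⟩)
  · exact Submodule.mem_sup_right (Submodule.subset_span ⟨i, j, hij, m, hm, n, hn, rfl⟩)

lemma ker_eq_bot (h : IsBracketCover s W κ)
    (hk : ∀ k, ∀ q ∈ coverPart s W k, κ q = 0 → q = 0) : LinearMap.ker κ = ⊥ := by
  refine LinearMap.ker_eq_bot'.2 fun q hq => ?_
  obtain ⟨q₀, h₀, q₁, h₁, rfl⟩ := Submodule.mem_sup.1 (h.coverPart_sup ▸ Submodule.mem_top : q ∈ _)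
  rw [map_add] at hq
  have hκ₀ : κ q₀ = 0 := by
    refine Submodule.disjoint_def.1 (isCompl_gr s).disjoint _ (h.map_coverPart_le 0 h₀) ?_
    rw [eq_neg_of_add_eq_zero_left hq]
    exact neg_mem (h.map_coverPart_le 1 h₁)
  have hκ₁ : κ q₁ = 0 := by simpa [hκ₀] using hq
  rw [hk 0 q₀ h₀ hκ₀, hk 1 q₁ h₁ hκ₁, add_zero]

/-- `κ` is injective in degree `k` if all brackets of degree `k` have the form `[z, m]`
for a fixed `m`. -/
lemma eq_zero_of_bk_eq_bk_right (h : IsBracketCover s W κ) {k i j : ZMod 2} {m : L}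
    (hm : m ∈ s.gr j)
    (hsurj : ∀ i' j' : ZMod 2, i' + j' = k → ∀ x ∈ s.gr i', ∀ y ∈ s.gr j',
      ∃ z ∈ s.gr i, s.bk x y = s.bk z m)
    (q : Q) (hq : q ∈ coverPart s W k) (hκ : κ q = 0) : q = 0 := by
  have hle : coverPart s W k ≤ (s.gr i).map (W.flip m) := by
    refine Submodule.span_le.2 ?_
    rintro _ ⟨i', j', hij, x, hx, y, hy, rfl⟩
    obtain ⟨z, hz, hxy⟩ := hsurj i' j' hij x hx y hy
    exact ⟨z, hz, (h.eq_of_bk_eq hx hy hz hm hxy).symm⟩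
  obtain ⟨z, hz, rfl⟩ := hle hq
  rw [LinearMap.flip_apply] at hκ ⊢
  exact h.eq_zero_of_bk_eq_zero hz hm (by rw [← h.map_eq_bk i j z hz m hm, hκ])

/-- The odd part when the even part of the algebra is a line. -/
lemma odd_of_finrank_even_eq_one (h : IsBracketCover s W κ)
    (h0 : Module.finrank ℝ (s.gr 0) = 1) {a : L} (ha : a ∈ s.gr 0) (ha0 : a ≠ 0) :
    ∀ q ∈ coverPart s W 1, κ q = 0 → q = 0 := by
  refine h.eq_zero_of_bk_eq_bk_right (i := 1) ha fun i j hij x hx y hy => ?_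
  rcases zmod_two_add_eq_one hij with ⟨rfl, rfl⟩ | ⟨rfl, rfl⟩
  · obtain ⟨c, rfl⟩ := exists_smul_eq h0 ha ha0 hx
    refine ⟨-(c • y), neg_mem (Submodule.smul_mem _ c hy), ?_⟩
    simp [bk_swap_of_even_odd s ha hy]
  · obtain ⟨c, rfl⟩ := exists_smul_eq h0 ha ha0 hy
    exact ⟨c • x, Submodule.smul_mem _ c hx, by simp⟩

/-- The odd part when the odd part of the algebra is a line. -/
lemma odd_of_finrank_odd_eq_one (h : IsBracketCover s W κ)
    (h1 : Module.finrank ℝ (s.gr 1) = 1) {α : L} (hα : α ∈ s.gr 1) (hα0 : α ≠ 0) :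
    ∀ q ∈ coverPart s W 1, κ q = 0 → q = 0 := by
  refine h.eq_zero_of_bk_eq_bk_right (i := 0) hα fun i j hij x hx y hy => ?_
  rcases zmod_two_add_eq_one hij with ⟨rfl, rfl⟩ | ⟨rfl, rfl⟩
  · obtain ⟨c, rfl⟩ := exists_smul_eq h1 hα hα0 hy
    exact ⟨c • x, Submodule.smul_mem _ c hx, by simp⟩
  · obtain ⟨c, rfl⟩ := exists_smul_eq h1 hα hα0 hx
    refine ⟨-(c • y), neg_mem (Submodule.smul_mem _ c hy), ?_⟩
    simp [bk_swap_of_even_odd s hy hα]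

lemma even_of_finrank_even_eq_one (h : IsBracketCover s W κ)
    (h0 : Module.finrank ℝ (s.gr 0) = 1) {u v : L} (hu : u ∈ s.gr 1) (hv : v ∈ s.gr 1)
    (huv : s.bk u v ≠ 0) : ∀ q ∈ coverPart s W 0, κ q = 0 → q = 0 := by
  refine h.eq_zero_of_bk_eq_bk_right (i := 1) hv fun i j hij x hx y hy => ?_
  have huv' : s.bk u v ∈ s.gr 0 := s.bk_gr 1 1 u hu v hv
  obtain ⟨c, hc⟩ := exists_smul_eq h0 huv' huv (hij ▸ s.bk_gr i j x hx y hy)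
  exact ⟨c • u, Submodule.smul_mem _ c hu, by simp [hc]⟩

/-- Every bivector in a three-dimensional space is decomposable. -/
lemma exists_eq_of_finrank_even_eq_three (h : IsBracketCover s W κ)
    (h0 : Module.finrank ℝ (s.gr 0) = 3) {q : Q}
    (hq : q ∈ Submodule.span ℝ {q : Q | ∃ m ∈ s.gr 0, ∃ n ∈ s.gr 0, q = W m n}) :
    ∃ x ∈ s.gr 0, ∃ y ∈ s.gr 0, q = W x y := by
  obtain ⟨a, ha, b, hb, c, hc, habc⟩ := exists_span_triple h0
  have hcomb : ∃ p r t : ℝ, q = p • W a b + r • W a c + t • W b c := by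
    induction hq using Submodule.span_induction with
    | mem q hq =>
      obtain ⟨m, hm, n, hn, rfl⟩ := hq
      obtain ⟨m₁, m₂, m₃, rfl⟩ := habc m hm
      obtain ⟨n₁, n₂, n₃, rfl⟩ := habc n hn
      refine ⟨m₁ * n₂ - m₂ * n₁, m₁ * n₃ - m₃ * n₁, m₂ * n₃ - m₃ * n₂, ?_⟩
      simp only [map_add, map_smul, LinearMap.add_apply, LinearMap.smul_apply,
        h.self_of_even ha, h.self_of_even hb, h.self_of_even hc,
        h.swap_of_even ha hb, h.swap_of_even ha hc, h.swap_of_even hb hc]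
      module
    | zero => exact ⟨0, 0, 0, by simp⟩
    | add q q' _ _ hq hq' =>
      obtain ⟨p, r, t, rfl⟩ := hq
      obtain ⟨p', r', t', rfl⟩ := hq'
      exact ⟨p + p', r + r', t + t', by module⟩
    | smul e q _ hq =>
      obtain ⟨p, r, t, rfl⟩ := hq
      exact ⟨e * p, e * r, e * t, by module⟩
  obtain ⟨p, r, t, rfl⟩ := hcomb
  have key : ∀ e : ℝ, ∀ {x}, x ∈ s.gr 0 → e • x ∈ s.gr 0 := fun e x hx => Submodule.smul_mem _ e hx
  rcases eq_or_ne p 0 with rfl | hp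
  · exact ⟨r • a + t • b, add_mem (key r ha) (key t hb), c, hc, by simp⟩
  · refine ⟨a - (t / p) • c, sub_mem ha (key _ hc), p • b + r • c,
      add_mem (key p hb) (key r hc), ?_⟩
    simp only [map_add, map_sub, map_smul, LinearMap.sub_apply, LinearMap.smul_apply,
      h.self_of_even hc, h.swap_of_even hb hc]
    match_scalars <;> field_simp

lemma even_of_finrank_odd_eq_one (h : IsBracketCover s W κ)
    (h0 : Module.finrank ℝ (s.gr 0) = 3) (h1 : Module.finrank ℝ (s.gr 1) = 1)
    {α : L} (hα : α ∈ s.gr 1) (hα0 : α ≠ 0) :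
    ∀ q ∈ coverPart s W 0, κ q = 0 → q = 0 := by
  intro q hq hκ
  have hle : coverPart s W 0 ≤
      Submodule.span ℝ {q : Q | ∃ m ∈ s.gr 0, ∃ n ∈ s.gr 0, q = W m n} ⊔
        Submodule.span ℝ {W α α} := by
    refine Submodule.span_le.2 ?_
    rintro _ ⟨i, j, hij, m, hm, n, hn, rfl⟩
    rcases zmod_two_add_eq_zero hij with ⟨rfl, rfl⟩ | ⟨rfl, rfl⟩
    · exact Submodule.mem_sup_left (Submodule.subset_span ⟨m, hm, n, hn, rfl⟩)
    · obtain ⟨c, rfl⟩ := exists_smul_eq h1 hα hα0 hm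
      obtain ⟨d, rfl⟩ := exists_smul_eq h1 hα hα0 hn
      refine Submodule.mem_sup_right (Submodule.mem_span_singleton.2 ⟨d * c, ?_⟩)
      simp [mul_smul]
  obtain ⟨q₀, hq₀, q₁, hq₁, rfl⟩ := Submodule.mem_sup.1 (hle hq)
  obtain ⟨x, hx, y, hy, rfl⟩ := h.exists_eq_of_finrank_even_eq_three h0 hq₀
  obtain ⟨c, rfl⟩ := Submodule.mem_span_singleton.1 hq₁
  rw [← LinearMap.smul_apply, ← map_smul] at hκ ⊢
  exact h.add_eq_zero_of_map_eq_zero hx hy (Submodule.smul_mem _ c hα) hα hκ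

/-- If two elements `a`, `b` suffice as first entries, every kernel element is a sum of two
values of `W`, hence vanishes. -/
lemma eq_zero_of_two_terms (h : IsBracketCover s W κ) {k i j : ZMod 2} {a b : L}
    (ha : a ∈ s.gr i) (hb : b ∈ s.gr i)
    (hgen : ∀ i' j' : ZMod 2, i' + j' = k → ∀ m ∈ s.gr i', ∀ n ∈ s.gr j',
      ∃ x ∈ s.gr j, ∃ y ∈ s.gr j, W m n = W a x + W b y)
    (q : Q) (hq : q ∈ coverPart s W k) (hκ : κ q = 0) : q = 0 := by
  have hle : coverPart s W k ≤ (s.gr j).map (W a) ⊔ (s.gr j).map (W b) := by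
    refine Submodule.span_le.2 ?_
    rintro _ ⟨i', j', hij, m, hm, n, hn, rfl⟩
    obtain ⟨x, hx, y, hy, hxy⟩ := hgen i' j' hij m hm n hn
    exact Submodule.mem_sup.2 ⟨_, ⟨x, hx, rfl⟩, _, ⟨y, hy, rfl⟩, hxy.symm⟩
  obtain ⟨_, ⟨x, hx, rfl⟩, _, ⟨y, hy, rfl⟩, rfl⟩ := Submodule.mem_sup.1 (hle hq)
  exact h.add_eq_zero_of_map_eq_zero ha hx hb hy hκ

lemma odd_of_finrank_even_eq_two (h : IsBracketCover s W κ)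
    (h0 : Module.finrank ℝ (s.gr 0) = 2) : ∀ q ∈ coverPart s W 1, κ q = 0 → q = 0 := by
  obtain ⟨a, ha, b, hb, hab⟩ := exists_span_pair h0
  refine h.eq_zero_of_two_terms (j := 1) ha hb fun i j hij m hm n hn => ?_
  rcases zmod_two_add_eq_one hij with ⟨rfl, rfl⟩ | ⟨rfl, rfl⟩
  · obtain ⟨c, d, rfl⟩ := hab m hm
    exact ⟨c • n, Submodule.smul_mem _ c hn, d • n, Submodule.smul_mem _ d hn, by simp⟩
  · obtain ⟨c, d, rfl⟩ := hab n hn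
    refine ⟨-(c • m), neg_mem (Submodule.smul_mem _ c hm),
      -(d • m), neg_mem (Submodule.smul_mem _ d hm), ?_⟩
    simp [h.swap_of_even_odd ha hm, h.swap_of_even_odd hb hm]

lemma even_of_bk_even_eq_zero (h : IsBracketCover s W κ)
    (h1 : Module.finrank ℝ (s.gr 1) = 2)
    (hab : ∀ x ∈ s.gr 0, ∀ y ∈ s.gr 0, s.bk x y = 0) :
    ∀ q ∈ coverPart s W 0, κ q = 0 → q = 0 := by
  obtain ⟨u, hu, v, hv, huv⟩ := exists_span_pair h1
  refine h.eq_zero_of_two_terms (j := 1) hu hv fun i j hij m hm n hn => ?_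
  rcases zmod_two_add_eq_zero hij with ⟨rfl, rfl⟩ | ⟨rfl, rfl⟩
  · refine ⟨0, zero_mem _, 0, zero_mem _, ?_⟩
    simp [h.eq_zero_of_bk_eq_zero hm hn (hab m hm n hn)]
  · obtain ⟨c, d, rfl⟩ := huv m hm
    exact ⟨c • n, Submodule.smul_mem _ c hn, d • n, Submodule.smul_mem _ d hn, by simp⟩

lemma even_of_finrank_eq_two (h : IsBracketCover s W κ)
    (h0 : Module.finrank ℝ (s.gr 0) = 2) (h1 : Module.finrank ℝ (s.gr 1) = 2) :
    ∀ q ∈ coverPart s W 0, κ q = 0 → q = 0 := by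
  obtain ⟨a, ha, b, hb, hab⟩ := exists_span_pair h0
  have hbk : ∀ c d c' d' : ℝ, s.bk (c • a + d • b) (c' • a + d' • b) =
      (c * d' - d * c') • s.bk a b := by
    intro c d c' d'
    simp only [map_add, map_smul, LinearMap.add_apply, LinearMap.smul_apply,
      s.even_sq a ha, s.even_sq b hb, bk_swap_of_even s hb ha]
    module
  by_cases hd : s.bk a b = 0
  · refine h.even_of_bk_even_eq_zero h1 fun x hx y hy => ?_
    obtain ⟨c, d, rfl⟩ := hab x hx
    obtain ⟨c', d', rfl⟩ := hab y hy
    rw [hbk, hd, smul_zero]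
  have hd0 : s.bk a b ∈ s.gr 0 := s.bk_gr 0 0 a ha b hb
  by_cases hsq : ∀ z ∈ s.gr 1, ∃ c : ℝ, c • s.bk a b = s.bk z z
  · refine h.eq_zero_of_bk_eq_bk_right (i := 0) hb fun i j hij x hx y hy => ?_
    suffices ∃ c : ℝ, c • s.bk a b = s.bk x y by
      obtain ⟨c, hc⟩ := this
      exact ⟨c • a, Submodule.smul_mem _ c ha, by simp [hc]⟩
    rcases zmod_two_add_eq_zero hij with ⟨rfl, rfl⟩ | ⟨rfl, rfl⟩
    · obtain ⟨c, d, rfl⟩ := hab x hx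
      obtain ⟨c', d', rfl⟩ := hab y hy
      exact ⟨_, (hbk c d c' d').symm⟩
    · obtain ⟨c, hc⟩ := hsq x hx
      obtain ⟨d, hd⟩ := hsq y hy
      obtain ⟨e, he⟩ := hsq (x + y) (add_mem hx hy)
      refine ⟨(e - c - d) / 2, ?_⟩
      simp only [map_add, LinearMap.add_apply, bk_comm_of_odd s hy hx] at he
      rw [div_eq_inv_mul, mul_smul, sub_smul, sub_smul, he, hc, hd]
      module
  · push Not at hsq
    obtain ⟨z, hz, hzz⟩ := hsq
    have hzz0 : s.bk z z ∈ s.gr 0 := s.bk_gr 1 1 z hz z hz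
    have hli : LinearIndependent ℝ ![s.bk a b, s.bk z z] :=
      (LinearIndependent.pair_iff' hd).2 hzz
    have hspan : Submodule.span ℝ {s.bk a b, s.bk z z} = s.gr 0 := by
      have : FiniteDimensional ℝ (s.gr 0) := Module.finite_of_finrank_pos (by omega)
      refine Submodule.eq_of_le_of_finrank_eq
        (Submodule.span_le.2 (Set.pair_subset hd0 hzz0)) ?_
      have := finrank_span_eq_card hli
      rw [Matrix.range_cons_cons_empty] at this
      simpa [h0] using this
    have hle : s.gr 0 ≤ (s.gr 1).map (s.bk.flip z) := by
      rw [← hspan]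
      refine Submodule.span_le.2 (Set.pair_subset ?_ ⟨z, hz, rfl⟩)
      have hmem : ∀ x ∈ s.gr 0, s.bk x (s.bk z z) ∈ (s.gr 1).map (s.bk.flip z) := by
        intro x hx
        rw [bk_bk_self_of_odd s hx hz]
        exact Submodule.smul_mem _ _ ⟨_, by simpa using s.bk_gr 0 1 x hx z hz, rfl⟩
      obtain ⟨c, d, hcd⟩ := hab _ hzz0
      have hA := hmem a ha
      have hB := hmem b hb
      have hA' := hbk 1 0 c d
      have hB' := hbk 0 1 c d
      rw [← hcd] at hA' hB'
      simp only [one_smul, zero_smul, add_zero, zero_add, one_mul, zero_mul, sub_zero,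
        zero_sub] at hA' hB'
      rw [hA'] at hA
      rw [hB'] at hB
      by_cases hd1 : d = 0
      · have hc : c ≠ 0 := by
          rintro rfl
          exact hzz 0 (by simp [hcd, hd1])
        exact (Submodule.smul_mem_iff _ (neg_ne_zero.2 hc)).1 hB
      · exact (Submodule.smul_mem_iff _ hd1).1 hA
    refine h.eq_zero_of_bk_eq_bk_right (i := 1) hz fun i j hij x hx y hy => ?_
    obtain ⟨t, ht, hxy⟩ := hle (hij ▸ s.bk_gr i j x hx y hy)
    exact ⟨t, ht, hxy.symm⟩

lemma ker_eq_bot_of_finrank_eq_four [FiniteDimensional ℝ L] (h : IsBracketCover s W κ)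
    (hdim : Module.finrank ℝ L = 4) {u v : L} (hu : u ∈ s.gr 1) (hv : v ∈ s.gr 1)
    (huv : s.bk u v ≠ 0) : LinearMap.ker κ = ⊥ := by
  have hsum := Submodule.finrank_add_eq_of_isCompl (isCompl_gr s)
  have huv0 : s.bk u v ∈ s.gr 0 := s.bk_gr 1 1 u hu v hv
  have hu0 : u ≠ 0 := by rintro rfl; simp at huv
  have h0 : 0 < Module.finrank ℝ (s.gr 0) :=
    Module.finrank_pos_iff_exists_ne_zero.2 ⟨⟨_, huv0⟩, by simpa using huv⟩
  have h1 : 0 < Module.finrank ℝ (s.gr 1) :=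
    Module.finrank_pos_iff_exists_ne_zero.2 ⟨⟨_, hu⟩, by simpa using hu0⟩
  refine h.ker_eq_bot fun k => ?_
  obtain h0 | h0 | h0 : Module.finrank ℝ (s.gr 0) = 1 ∨ Module.finrank ℝ (s.gr 0) = 2 ∨
      Module.finrank ℝ (s.gr 0) = 3 := by omega
  · rcases zmod_two_eq k with rfl | rfl
    · exact h.even_of_finrank_even_eq_one h0 hu hv huv
    · exact h.odd_of_finrank_even_eq_one h0 huv0 huv
  · rcases zmod_two_eq k with rfl | rfl
    · exact h.even_of_finrank_eq_two h0 (by omega)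
    · exact h.odd_of_finrank_even_eq_two h0
  · rcases zmod_two_eq k with rfl | rfl
    · exact h.even_of_finrank_odd_eq_one h0 (by omega) hu hu0
    · exact h.odd_of_finrank_odd_eq_one (by omega) hu hu0

end IsBracketCover

end Cover

section ExteriorProduct

variable {L E : Type v} [AddCommGroup L] [Module ℝ L] [AddCommGroup E] [Module ℝ E]
  {s : SuperAlg ℝ L} {t : SuperAlg ℝ E} {w : L → L → E}

/-- An exterior pairing is the restriction of a bilinear map to homogeneous elements. -/
lemma IsExtPairing.exists_bilinear (h : IsExtPairing s ⊤ ⊤ t w) :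
    ∃ W : L →ₗ[ℝ] L →ₗ[ℝ] E, ∀ i j : ZMod 2, ∀ m ∈ s.gr i, ∀ n ∈ s.gr j, W m n = w m n := by
  obtain ⟨B, hB⟩ : ∃ B : ∀ i j : ZMod 2, s.gr i →ₗ[ℝ] s.gr j →ₗ[ℝ] E,
      ∀ i j m n, B i j m n = w m n :=
    ⟨fun i j => LinearMap.mk₂ ℝ (fun m n => w m n)
      (fun m m' n => h.add_left i j m ⟨trivial, m.2⟩ m' ⟨trivial, m'.2⟩ n ⟨trivial, n.2⟩)
      (fun c m n => h.smul_left c i j m ⟨trivial, m.2⟩ n ⟨trivial, n.2⟩)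
      (fun m n n' => h.add_right i j m ⟨trivial, m.2⟩ n ⟨trivial, n.2⟩ n' ⟨trivial, n'.2⟩)
      (fun c m n => h.smul_right c i j m ⟨trivial, m.2⟩ n ⟨trivial, n.2⟩),
      fun _ _ _ _ => rfl⟩
  have hc := isCompl_gr s
  let p₀ := (s.gr 0).projectionOnto (s.gr 1) hc
  let p₁ := (s.gr 1).projectionOnto (s.gr 0) hc.symm
  have h00 : ∀ m (hm : m ∈ s.gr 0), p₀ m = ⟨m, hm⟩ := fun m hm =>
    Submodule.projectionOnto_apply_left hc ⟨m, hm⟩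
  have h01 : ∀ m (hm : m ∈ s.gr 1), p₀ m = 0 := fun m hm =>
    Submodule.projectionOnto_apply_right hc ⟨m, hm⟩
  have h11 : ∀ m (hm : m ∈ s.gr 1), p₁ m = ⟨m, hm⟩ := fun m hm =>
    Submodule.projectionOnto_apply_left hc.symm ⟨m, hm⟩
  have h10 : ∀ m (hm : m ∈ s.gr 0), p₁ m = 0 := fun m hm =>
    Submodule.projectionOnto_apply_right hc.symm ⟨m, hm⟩
  refine ⟨(B 0 0).compl₁₂ p₀ p₀ + (B 0 1).compl₁₂ p₀ p₁ + (B 1 0).compl₁₂ p₁ p₀ +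
    (B 1 1).compl₁₂ p₁ p₁, fun i j m hm n hn => ?_⟩
  simp only [LinearMap.add_apply, LinearMap.compl₁₂_apply]
  rcases zmod_two_eq i with rfl | rfl <;> rcases zmod_two_eq j with rfl | rfl <;>
    simp only [h00, h01, h10, h11, hm, hn, map_zero, LinearMap.zero_apply, add_zero,
      zero_add] <;> exact hB _ _ _ _

lemma M0_le_ker {κ : E →ₗ[ℝ] L} (hκ : IsCommMap s ⊤ ⊤ w κ) : M0 s ⊤ ⊤ w ≤ LinearMap.ker κ := by
  refine Submodule.span_le.2 ?_
  rintro _ (⟨i, j, i', j', m, hm, n, hn, m', hm', n', hn', h0, rfl⟩ | ⟨m, hm, n, hn, h0, rfl⟩)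
  · simpa [hκ i j m hm n hn, hκ i' j' m' hm' n' hn'] using h0
  · simpa [hκ 0 0 m hm n hn] using h0

lemma sub_mem_M0_of_bk_eq (h : IsExtPairing s ⊤ ⊤ t w) {i j i' j' : ZMod 2} {m n m' n' : L}
    (hm : m ∈ s.gr i) (hn : n ∈ s.gr j) (hm' : m' ∈ s.gr i') (hn' : n' ∈ s.gr j')
    (hbk : s.bk m n = s.bk m' n') : w m n - w m' n' ∈ M0 s ⊤ ⊤ w := by
  have hsq : ((sgn i' j' : ℤ) : ℝ) * (sgn i' j' : ℤ) = 1 := mod_cast sgn_mul_self i' j'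
  refine Submodule.subset_span (Or.inl ⟨i, j, i', j', m, ⟨trivial, hm⟩, n, ⟨trivial, hn⟩,
    (-(sgn i' j' : ℝ)) • m', ⟨trivial, Submodule.smul_mem _ _ hm'⟩, n', ⟨trivial, hn'⟩, ?_, ?_⟩)
  · rw [map_smul, LinearMap.smul_apply, ← Int.cast_smul_eq_zsmul ℝ, smul_smul, mul_neg, hsq, hbk]
    module
  · rw [h.smul_left _ i' j' m' ⟨trivial, hm'⟩ n' ⟨trivial, hn'⟩, ← Int.cast_smul_eq_zsmul ℝ,
      smul_smul, mul_neg, hsq]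
    module

/-- The quotient of the exterior product by `M₀(L)` is a bracket cover. -/
lemma IsExtProduct.exists_isBracketCover (h : IsExtProduct s ⊤ ⊤ t w) {κ : E →ₗ[ℝ] L}
    (hκ : IsCommMap s ⊤ ⊤ w κ) :
    ∃ W : L →ₗ[ℝ] L →ₗ[ℝ] (E ⧸ M0 s ⊤ ⊤ w),
      IsBracketCover s W ((M0 s ⊤ ⊤ w).liftQ κ (M0_le_ker hκ)) := by
  obtain ⟨W, hW⟩ := h.pairing.exists_bilinear
  refine ⟨W.compr₂ (M0 s ⊤ ⊤ w).mkQ, ?_, ?_, ?_⟩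
  · intro i j m hm n hn
    simp [hW i j m hm n hn, hκ i j m ⟨trivial, hm⟩ n ⟨trivial, hn⟩]
  · intro i j i' j' m n m' n' hm hn hm' hn' hbk
    simp only [LinearMap.compr₂_apply, Submodule.mkQ_apply, hW i j m hm n hn,
      hW i' j' m' hm' n' hn']
    exact (Submodule.Quotient.eq _).2 (sub_mem_M0_of_bk_eq h.pairing hm hn hm' hn' hbk)
  · rw [← (M0 s ⊤ ⊤ w).range_mkQ, LinearMap.range_eq_map, ← h.gen, Submodule.map_span]
    congr 1
    ext q
    constructor
    · rintro ⟨i, j, m, hm, n, hn, rfl⟩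
      exact ⟨w m n, ⟨i, j, m, ⟨trivial, hm⟩, n, ⟨trivial, hn⟩, rfl⟩, by simp [hW i j m hm n hn]⟩
    · rintro ⟨_, ⟨i, j, m, hm, n, hn, rfl⟩, rfl⟩
      exact ⟨i, j, m, hm.2, n, hn.2, by simp [hW i j m hm.2 n hn.2]⟩

end ExteriorProduct

/-- Every nontrivial real Lie superalgebra `L` of dimension `4`
(i.e. `[L₁, L₁] ≠ 0`; by Backhouse's classification these are exactly the
algebras of types `(3,1)`, `(2,2)` and `(1,3)` listed in the paper, e.g.
`L³_{(3,1)}`, `L¹_{(2,2)}`, `L¹¹_{(2,2)}` and `L¹_{(1,3)}`) has trivial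
Bogomolov multiplier `B̃₀(L) = 0`. -/
theorem nontrivial_real_dim_four_trivial_bogomolov
    {L : Type v} [AddCommGroup L] [Module ℝ L] [FiniteDimensional ℝ L]
    (s : SuperAlg ℝ L)
    (hdim : Module.finrank ℝ L = 4)
    (hnontriv : ∃ u ∈ s.gr 1, ∃ v ∈ s.gr 1, s.bk u v ≠ 0) :
    HasTrivialBog s := by
  intro E _ _ t w hw κ hκ
  obtain ⟨u, hu, v, hv, huv⟩ := hnontriv
  obtain ⟨W, hW⟩ := hw.exists_isBracketCover hκ
  have hker := hW.ker_eq_bot_of_finrank_eq_four hdim hu hv huv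
  intro e he
  rw [← Submodule.Quotient.mk_eq_zero, ← Submodule.mem_bot ℝ, ← hker, LinearMap.mem_ker]
  simpa using he

end BogomolovSuper
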